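/- arXiv:1405.7606 — 7 statements merged into one kernel-verified Lean document; each statement's English description precedes it below -/
import Mathlib

section
/- Let (Ω, 𝓕, P) be a probability space and let Z_1 ≤ Z_2 ≤ … be a nondecreasing sequence of measurable random variables with values in the positive reals. Suppose there exist constants β > 0, μ > 0 and C > 0 such that P( Z_r ≥ λ · r^β ) ≤ C / (log λ)^{1+μ} for every real λ > 1 and every integer r ≥ 1. Then P( limsup_{r→∞} (log Z_r)/(log r) ≤ β ) = 1. -/
open MeasureTheory Filter

/-- Borel–Cantelli along the dyadic subsequence. -/
theorem ae_eventually_dyadic_lt {Ω : Type*} [MeasurableSpace Ω] {P : Measure Ω}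
    {Z : ℕ → Ω → ℝ} {β μ C ε : ℝ} (hμ : 0 < μ) (hε : 0 < ε)
    (hTail : ∀ l : ℝ, 1 < l → ∀ r : ℕ, 1 ≤ r →
      P {ω | l * (r : ℝ) ^ β ≤ Z r ω} ≤ ENNReal.ofReal (C / Real.log l ^ (1 + μ))) :
    ∀ᵐ ω ∂P, ∀ᶠ k : ℕ in atTop, Z (2 ^ k) ω < ((2 : ℝ) ^ k) ^ (β + ε) := by
  have hlog2 : 0 < Real.log 2 := Real.log_pos one_lt_two
  have hbound (k : ℕ) : P {ω | ((2 : ℝ) ^ (k + 1)) ^ (β + ε) ≤ Z (2 ^ (k + 1)) ω} ≤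
      ENNReal.ofReal (C / (ε * Real.log 2) ^ (1 + μ) * (1 / ((k + 1 : ℕ) : ℝ) ^ (1 + μ))) := by
    have hpow : (1 : ℝ) < 2 ^ (k + 1) := one_lt_pow₀ one_lt_two k.succ_ne_zero
    have hscale : ((2 : ℝ) ^ (k + 1)) ^ (β + ε) =
        ((2 : ℝ) ^ (k + 1)) ^ ε * ((2 ^ (k + 1) : ℕ) : ℝ) ^ β := by
      push_cast
      rw [← Real.rpow_add (by positivity), add_comm ε]
    have hlog : Real.log (((2 : ℝ) ^ (k + 1)) ^ ε) = ε * Real.log 2 * ((k + 1 : ℕ) : ℝ) := by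
      rw [Real.log_rpow (by positivity), Real.log_pow]
      ring
    rw [hscale, div_mul_div_comm, mul_one, ← Real.mul_rpow (by positivity) (by positivity), ← hlog]
    exact hTail _ (Real.one_lt_rpow hpow hε) _ Nat.one_le_two_pow
  have hsum : Summable fun k : ℕ ↦
      C / (ε * Real.log 2) ^ (1 + μ) * (1 / ((k + 1 : ℕ) : ℝ) ^ (1 + μ)) :=
    ((summable_nat_add_iff 1).2 (Real.summable_one_div_nat_rpow.2 (by linarith))).mul_left _
  have hfin : ∑' k : ℕ, P {ω | ((2 : ℝ) ^ (k + 1)) ^ (β + ε) ≤ Z (2 ^ (k + 1)) ω} ≠ ⊤ :=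
    ne_top_of_le_ne_top hsum.tsum_ofReal_ne_top (ENNReal.tsum_le_tsum hbound)
  filter_upwards [ae_eventually_notMem hfin] with ω hω
  rw [← map_add_atTop_eq_nat 1, eventually_map]
  filter_upwards [hω] with k hk using not_le.1 hk

/-- A dyadic power bound on a nondecreasing sequence bounds its logarithmic growth rate. -/
theorem eventually_log_div_log_le {z : ℕ → ℝ} {β δ : ℝ} (hβ : 0 < β) (hδ : 0 < δ)
    (hpos : ∀ r : ℕ, 1 ≤ r → 0 < z r) (hmono : ∀ r : ℕ, 1 ≤ r → z r ≤ z (r + 1))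
    (hz : ∀ᶠ k : ℕ in atTop, z (2 ^ k) < ((2 : ℝ) ^ k) ^ (β + δ / 2)) :
    ∀ᶠ r : ℕ in atTop, Real.log (z r) / Real.log r ≤ β + δ := by
  have hmon : MonotoneOn z (Set.Ici 1) := monotoneOn_of_le_add_one Set.ordConnected_Ici
    fun r _ hr _ ↦ hmono r hr
  have hlogTop : Tendsto (fun r : ℕ ↦ Real.log r) atTop atTop :=
    Real.tendsto_log_atTop.comp tendsto_natCast_atTop_atTop
  have hkTop : Tendsto (fun r : ℕ ↦ Nat.log 2 r + 1) atTop atTop := by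
    refine tendsto_atTop.2 fun b ↦ ?_
    filter_upwards [eventually_ge_atTop (2 ^ b)] with r hr
    exact (Nat.le_log_of_pow_le one_lt_two hr).trans (Nat.le_succ _)
  filter_upwards [hkTop.eventually hz, eventually_ge_atTop 2,
    hlogTop.eventually_ge_atTop ((β + δ / 2) * Real.log 2 / (δ / 2))] with r hr hr2 hlog
  have hrpos : (0 : ℝ) < r := by positivity
  have hlogpos : 0 < Real.log r := Real.log_pos (by exact_mod_cast hr2)
  have hle : z r ≤ z (2 ^ (Nat.log 2 r + 1)) :=
    hmon (show 1 ≤ r by omega) Nat.one_le_two_pow (Nat.lt_pow_succ_log_self one_lt_two r).le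
  have hpow : (2 : ℝ) ^ (Nat.log 2 r + 1) ≤ 2 * r := by
    rw [pow_succ']
    gcongr
    exact_mod_cast Nat.pow_log_le_self 2 (by omega : r ≠ 0)
  have hzr : z r ≤ (2 * r : ℝ) ^ (β + δ / 2) :=
    (hle.trans hr.le).trans (Real.rpow_le_rpow (by positivity) hpow (by positivity))
  have hlogz := Real.log_le_log (hpos r (by omega)) hzr
  rw [Real.log_rpow (by positivity), Real.log_mul two_ne_zero hrpos.ne'] at hlogz
  rw [div_le_iff₀ (by positivity)] at hlog
  rw [div_le_iff₀ hlogpos]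
  linarith

/-- If `Z_1 ≤ Z_2 ≤ …` are positive random variables with
`P(Z_r ≥ λ·r^β) ≤ C/(log λ)^{1+μ}`, then almost surely
`limsup (log Z_r)/(log r) ≤ β`. -/
theorem iic_limsup_of_tail
    {Ω : Type*} [MeasurableSpace Ω] (P : Measure Ω) [IsProbabilityMeasure P]
    (Z : ℕ → Ω → ℝ)
    (hmeas : ∀ r, Measurable (Z r))
    (hpos : ∀ r : ℕ, 1 ≤ r → ∀ ω, 0 < Z r ω)
    (hmono : ∀ r : ℕ, 1 ≤ r → ∀ ω, Z r ω ≤ Z (r + 1) ω)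
    (β μ C : ℝ) (hβ : 0 < β) (hμ : 0 < μ) (hC : 0 < C)
    (hTail : ∀ l : ℝ, 1 < l → ∀ r : ℕ, 1 ≤ r →
      P {ω | l * (r : ℝ) ^ β ≤ Z r ω} ≤ ENNReal.ofReal (C / Real.log l ^ (1 + μ))) :
    P {ω | limsup (fun r : ℕ =>
        ((Real.log (Z r ω) / Real.log r : ℝ) : EReal)) atTop ≤ (β : EReal)} = 1 := by
  have hae : ∀ᵐ ω ∂P, ∀ n : ℕ, ∀ᶠ k : ℕ in atTop,
      Z (2 ^ k) ω < ((2 : ℝ) ^ k) ^ (β + 1 / ((n : ℝ) + 1) / 2) :=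
    ae_all_iff.2 fun n ↦ ae_eventually_dyadic_lt hμ (by positivity) hTail
  refine (measure_congr (eventuallyEq_univ.2 ?_)).trans measure_univ
  filter_upwards [hae] with ω hω
  have hlim : Tendsto (fun n : ℕ ↦ ((β + 1 / ((n : ℝ) + 1) : ℝ) : EReal)) atTop (nhds β) := by
    refine (continuous_coe_real_ereal.tendsto β).comp ?_
    simpa using tendsto_one_div_add_atTop_nhds_zero_nat.const_add β
  refine ge_of_tendsto' hlim fun n ↦ limsup_le_of_le (by isBoundedDefault) ?_
  filter_upwards [eventually_log_div_log_le hβ (by positivity) (fun r hr ↦ hpos r hr ω)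
    (fun r hr ↦ hmono r hr ω) (hω n)] with r hr
  exact_mod_cast hr
end

section
/- Let (Ω, 𝓕, P) be a probability space and let Z_1 ≤ Z_2 ≤ … be a nondecreasing sequence of measurable random variables with values in the positive reals. Suppose there exist constants α > 0 and C > 0 such that E[1/Z_r] ≤ C · r^{−α} for every integer r ≥ 1. Then P( liminf_{r→∞} (log Z_r)/(log r) ≥ α ) = 1. -/
open MeasureTheory Filter

/-- If `E[1/Z_r] ≤ C·r^{-α}`, then for `β < α` almost surely `Z_{2^k} > 2^{kβ}` eventually. -/
theorem ae_eventually_rpow_lt_of_integral_inv_le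
    {Ω : Type*} [MeasurableSpace Ω] {P : Measure Ω} [IsProbabilityMeasure P]
    {Z : ℕ → Ω → ℝ} (hpos : ∀ r : ℕ, 1 ≤ r → ∀ ω, 0 < Z r ω) {α β C : ℝ} (hβ : β < α)
    (hint : ∀ r : ℕ, 1 ≤ r → Integrable (fun ω => (Z r ω)⁻¹) P)
    (hE : ∀ r : ℕ, 1 ≤ r → (∫ ω, (Z r ω)⁻¹ ∂P) ≤ C * (r : ℝ) ^ (-α)) :
    ∀ᵐ ω ∂P, ∀ᶠ k : ℕ in atTop, ((2 : ℝ) ^ k) ^ β < Z (2 ^ k) ω := by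
  have hbound (k : ℕ) : P.real {ω | Z (2 ^ k) ω ≤ ((2 : ℝ) ^ k) ^ β} ≤
      C * ((2 : ℝ) ^ (β - α)) ^ k := by
    have hr : 1 ≤ 2 ^ k := Nat.one_le_two_pow
    have h2 : (0 : ℝ) < 2 ^ k := by positivity
    have hb : 0 < ((2 : ℝ) ^ k) ^ β := by positivity
    have hM := mul_meas_ge_le_integral_of_nonneg
      (ae_of_all P fun ω => (inv_pos.2 (hpos _ hr ω)).le) (hint _ hr) (((2 : ℝ) ^ k) ^ β)⁻¹
    have hset : {ω | (((2 : ℝ) ^ k) ^ β)⁻¹ ≤ (Z (2 ^ k) ω)⁻¹} =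
        {ω | Z (2 ^ k) ω ≤ ((2 : ℝ) ^ k) ^ β} := by
      ext ω
      exact inv_le_inv₀ hb (hpos _ hr ω)
    rw [hset] at hM
    have h := (inv_mul_le_iff₀ hb).1 (hM.trans (hE _ hr))
    refine h.trans_eq ?_
    push_cast
    rw [mul_left_comm, ← Real.rpow_add h2, ← sub_eq_add_neg, ← Real.rpow_natCast,
      ← Real.rpow_natCast, ← Real.rpow_mul two_pos.le, ← Real.rpow_mul two_pos.le, mul_comm (k : ℝ)]
  have hsum : Summable fun k : ℕ => C * ((2 : ℝ) ^ (β - α)) ^ k :=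
    (summable_geometric_of_lt_one (by positivity)
      (Real.rpow_lt_one_of_one_lt_of_neg one_lt_two (sub_neg.2 hβ))).mul_left C
  have hfin : ∑' k : ℕ, P {ω | Z (2 ^ k) ω ≤ ((2 : ℝ) ^ k) ^ β} ≠ ⊤ := by
    refine ne_top_of_le_ne_top hsum.tsum_ofReal_ne_top (ENNReal.tsum_le_tsum fun k => ?_)
    rw [← ofReal_measureReal]
    exact ENNReal.ofReal_le_ofReal (hbound k)
  filter_upwards [ae_eventually_notMem hfin] with ω hω
  filter_upwards [hω] with k hk
  exact not_le.1 hk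

/-- Growth along powers of two of a sequence that is nondecreasing from index one on
extends to all indices, up to a factor of two. -/
theorem eventually_div_two_rpow_le {z : ℕ → ℝ} (hmono : ∀ r : ℕ, 1 ≤ r → z r ≤ z (r + 1))
    {β : ℝ} (hβ : 0 ≤ β) (h : ∀ᶠ k : ℕ in atTop, ((2 : ℝ) ^ k) ^ β < z (2 ^ k)) :
    ∀ᶠ r : ℕ in atTop, ((r : ℝ) / 2) ^ β ≤ z r := by
  obtain ⟨K, hK⟩ := eventually_atTop.1 h
  filter_upwards [eventually_ge_atTop (2 ^ K)] with r hr
  have hr0 : r ≠ 0 := (Nat.two_pow_pos K |>.trans_le hr).ne'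
  have hle : 2 ^ Nat.log 2 r ≤ r := Nat.pow_log_le_self 2 hr0
  have hlt : (r : ℝ) < 2 ^ (Nat.log 2 r + 1) := by
    exact_mod_cast Nat.lt_pow_succ_log_self one_lt_two r
  calc ((r : ℝ) / 2) ^ β ≤ ((2 : ℝ) ^ Nat.log 2 r) ^ β := by
        refine Real.rpow_le_rpow (by positivity) ?_ hβ
        rw [pow_succ] at hlt
        linarith
    _ ≤ z (2 ^ Nat.log 2 r) := (hK _ (Nat.le_log_of_pow_le one_lt_two hr)).le
    _ ≤ z r := Nat.rel_of_forall_rel_succ_of_le_of_le (· ≤ ·) hmono Nat.one_le_two_pow hle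

/-- If `z_r ≥ (r/2)^β` eventually and `c < β`, then `log z_r / log r ≥ c` eventually. -/
theorem eventually_le_log_div_log {z : ℕ → ℝ} {β c : ℝ} (hc : c < β)
    (h : ∀ᶠ r : ℕ in atTop, ((r : ℝ) / 2) ^ β ≤ z r) :
    ∀ᶠ r : ℕ in atTop, c ≤ Real.log (z r) / Real.log r := by
  have hlog : Tendsto (fun r : ℕ => Real.log r) atTop atTop :=
    Real.tendsto_log_atTop.comp tendsto_natCast_atTop_atTop
  filter_upwards [h, hlog.eventually_ge_atTop (β * Real.log 2 / (β - c)),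
    eventually_gt_atTop 1] with r hr hrlog hr1
  have hr1' : (1 : ℝ) < r := by exact_mod_cast hr1
  have hr0 : (0 : ℝ) < r := by linarith
  rw [le_div_iff₀ (Real.log_pos hr1')]
  rw [div_le_iff₀ (sub_pos.2 hc)] at hrlog
  have hl := Real.log_le_log (by positivity) hr
  rw [Real.log_rpow (by positivity), Real.log_div hr0.ne' two_ne_zero] at hl
  linarith

/-- If `Z_1 ≤ Z_2 ≤ …` are positive random variables with `E[1/Z_r] ≤ C·r^{-α}`,
then almost surely `liminf (log Z_r)/(log r) ≥ α`. -/
theorem iic_liminf_of_expectation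
    {Ω : Type*} [MeasurableSpace Ω] (P : Measure Ω) [IsProbabilityMeasure P]
    (Z : ℕ → Ω → ℝ)
    (hmeas : ∀ r, Measurable (Z r))
    (hpos : ∀ r : ℕ, 1 ≤ r → ∀ ω, 0 < Z r ω)
    (hmono : ∀ r : ℕ, 1 ≤ r → ∀ ω, Z r ω ≤ Z (r + 1) ω)
    (α C : ℝ) (hα : 0 < α) (hC : 0 < C)
    (hint : ∀ r : ℕ, 1 ≤ r → Integrable (fun ω => (Z r ω)⁻¹) P)
    (hE : ∀ r : ℕ, 1 ≤ r → (∫ ω, (Z r ω)⁻¹ ∂P) ≤ C * (r : ℝ) ^ (-α)) :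
    P {ω | (α : EReal) ≤ liminf (fun r : ℕ =>
        ((Real.log (Z r ω) / Real.log r : ℝ) : EReal)) atTop} = 1 := by
  have hae : ∀ᵐ ω ∂P, ∀ q : ℚ, (q : ℝ) < α →
      ∀ᶠ k : ℕ in atTop, ((2 : ℝ) ^ k) ^ (q : ℝ) < Z (2 ^ k) ω := by
    refine ae_all_iff.2 fun q => ?_
    by_cases hq : (q : ℝ) < α
    · filter_upwards [ae_eventually_rpow_lt_of_integral_inv_le hpos hq hint hE] with ω hω _
      exact hω
    · exact ae_of_all P fun ω h => absurd h hq
  rw [← measure_univ (μ := P)]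
  refine measure_congr (eventuallyEq_univ.2 ?_)
  filter_upwards [hae] with ω hω
  refine EReal.ge_of_forall_gt_iff_ge.1 fun c hc => ?_
  obtain ⟨q, hcq, hqα⟩ := exists_rat_btwn (max_lt (EReal.coe_lt_coe_iff.1 hc) hα)
  refine le_liminf_of_le (by isBoundedDefault) ?_
  filter_upwards [eventually_le_log_div_log ((le_max_left c 0).trans_lt hcq)
    (eventually_div_two_rpow_le (fun r hr => hmono r hr ω)
      ((le_max_right c 0).trans hcq.le) (hω q hqα))] with r hr
  exact EReal.coe_le_coe_iff.2 hr
end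

section
/- Let (Ω, 𝓕, P) be a probability space and let Z_1 ≤ Z_2 ≤ … be a nondecreasing sequence of measurable random variables with values in the positive reals. Suppose there exist constants α > 0, μ > 0 and C > 0 such that P( Z_r ≤ (1/λ) · r^α ) ≤ C / (log λ)^{1+μ} for every real λ > 1 and every integer r ≥ 1. Then P( liminf_{r→∞} (log Z_r)/(log r) ≥ α ) = 1. -/
open MeasureTheory Filter

/-- If a positive sequence is nondecreasing from index `1` on and exceeds `(2 ^ k) ^ b` at `2 ^ k`
for all large `k`, then the lower growth exponent of the sequence is at least `b`. -/
theorem le_liminf_log_div_log_of_dyadic (z : ℕ → ℝ) (hpos : ∀ r, 1 ≤ r → 0 < z r)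
    (hmono : ∀ r, 1 ≤ r → z r ≤ z (r + 1)) {b : ℝ} (hb : 0 < b)
    (h : ∀ᶠ k : ℕ in atTop, Real.exp (b * (k * Real.log 2)) < z (2 ^ k)) :
    (b : EReal) ≤ liminf (fun r : ℕ => ((Real.log (z r) / Real.log r : ℝ) : EReal)) atTop := by
  have hlog2 : 0 < Real.log 2 := Real.log_pos one_lt_two
  have hlog : Tendsto (fun r : ℕ => Real.log r) atTop atTop :=
    Real.tendsto_log_atTop.comp tendsto_natCast_atTop_atTop
  have hlim : Tendsto (fun r : ℕ => ((b - b * Real.log 2 / Real.log r : ℝ) : EReal)) atTop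
      (nhds (b : EReal)) := by
    refine (continuous_coe_real_ereal.tendsto b).comp ?_
    simpa using tendsto_const_nhds.sub (hlog.const_div_atTop (b * Real.log 2))
  rw [← hlim.liminf_eq]
  refine liminf_le_liminf ?_
  obtain ⟨K, hK⟩ := eventually_atTop.1 h
  filter_upwards [eventually_ge_atTop (2 ^ K), eventually_ge_atTop 2] with r hrK hr2
  have hr0 : r ≠ 0 := by omega
  have hlogr : 0 < Real.log r := Real.log_pos (by exact_mod_cast hr2)
  set k := Nat.log 2 r
  have hKk : K ≤ k := (Nat.le_log_iff_pow_le one_lt_two hr0).2 hrK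
  have hle : z (2 ^ k) ≤ z r :=
    Nat.rel_of_forall_rel_succ_of_le_of_le (fun x y : ℝ => x ≤ y) (f := z)
      hmono Nat.one_le_two_pow (Nat.pow_log_le_self 2 hr0)
  have hlow : b * (k * Real.log 2) ≤ Real.log (z r) :=
    (Real.le_log_iff_exp_le (hpos r (by omega))).2 ((hK k hKk).le.trans hle)
  have hup : Real.log r ≤ (k + 1) * Real.log 2 := by
    have hlt : (r : ℝ) ≤ 2 ^ (k + 1) := by
      exact_mod_cast (Nat.lt_pow_succ_log_self one_lt_two r).le
    have := Real.log_le_log (by positivity) hlt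
    rwa [Real.log_pow, Nat.cast_succ] at this
  rw [EReal.coe_le_coe_iff, le_div_iff₀ hlogr, sub_mul, div_mul_cancel₀ _ hlogr.ne']
  nlinarith

/-- Borel–Cantelli along powers of two: under a tail bound of order `(log l) ^ (-(1 + μ))`, almost
surely `Z (2 ^ k)` exceeds `(2 ^ k) ^ b` for all large `k`, for each `b < α`. -/
theorem ae_eventually_dyadic_lt_of_tail {Ω : Type*} [MeasurableSpace Ω] (P : Measure Ω)
    (Z : ℕ → Ω → ℝ) {α μ C b : ℝ} (hμ : 0 < μ) (hb : b < α)
    (hTail : ∀ l : ℝ, 1 < l → ∀ r : ℕ, 1 ≤ r →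
      P {ω | Z r ω ≤ (1 / l) * (r : ℝ) ^ α} ≤ ENNReal.ofReal (C / Real.log l ^ (1 + μ))) :
    ∀ᵐ ω ∂P, ∀ᶠ k : ℕ in atTop, Real.exp (b * (k * Real.log 2)) < Z (2 ^ k) ω := by
  have hlog2 : 0 < Real.log 2 := Real.log_pos one_lt_two
  have hc : 0 < (α - b) * Real.log 2 := mul_pos (sub_pos.2 hb) hlog2
  have hbound : ∀ k : ℕ, P {ω | Z (2 ^ (k + 1)) ω ≤ Real.exp (b * ((k + 1 : ℕ) * Real.log 2))} ≤
      ENNReal.ofReal (C / ((α - b) * Real.log 2) ^ (1 + μ) *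
        (1 / ((k + 1 : ℕ) : ℝ) ^ (1 + μ))) := by
    intro k
    have hk : (0 : ℝ) < (k + 1 : ℕ) := by positivity
    have hl : 1 < Real.exp ((α - b) * Real.log 2 * (k + 1 : ℕ)) :=
      Real.one_lt_exp_iff.2 (mul_pos hc hk)
    have := hTail _ hl (2 ^ (k + 1)) Nat.one_le_two_pow
    rw [Real.log_exp, Real.mul_rpow hc.le hk.le, one_div, ← Real.exp_neg,
      Real.rpow_def_of_pos (by positivity), ← Real.exp_add, Nat.cast_pow, Real.log_pow,
      Nat.cast_two] at this
    have hexp : -((α - b) * Real.log 2 * (k + 1 : ℕ)) + (k + 1 : ℕ) * Real.log 2 * α =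
        b * ((k + 1 : ℕ) * Real.log 2) := by ring
    rw [hexp] at this
    convert this using 2
    field_simp
  have hsum : Summable fun k : ℕ => C / ((α - b) * Real.log 2) ^ (1 + μ) *
      (1 / ((k + 1 : ℕ) : ℝ) ^ (1 + μ)) :=
    ((summable_nat_add_iff 1).2
      (Real.summable_one_div_nat_rpow.2 (by linarith : 1 < 1 + μ))).mul_left _
  have hfin : ∑' k : ℕ, P {ω | Z (2 ^ (k + 1)) ω ≤
      Real.exp (b * ((k + 1 : ℕ) * Real.log 2))} ≠ ⊤ :=
    ne_top_of_le_ne_top hsum.tsum_ofReal_ne_top (ENNReal.tsum_le_tsum hbound)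
  filter_upwards [ae_eventually_notMem hfin] with ω hω
  rw [← map_add_atTop_eq_nat 1, eventually_map]
  filter_upwards [hω] with k hk
  exact not_le.1 hk

/-- If `Z_1 ≤ Z_2 ≤ …` are positive random variables with
`P(Z_r ≤ (1/λ)·r^α) ≤ C/(log λ)^{1+μ}`, then almost surely
`liminf (log Z_r)/(log r) ≥ α`. -/
theorem iic_liminf_of_tail
    {Ω : Type*} [MeasurableSpace Ω] (P : Measure Ω) [IsProbabilityMeasure P]
    (Z : ℕ → Ω → ℝ)
    (hmeas : ∀ r, Measurable (Z r))
    (hpos : ∀ r : ℕ, 1 ≤ r → ∀ ω, 0 < Z r ω)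
    (hmono : ∀ r : ℕ, 1 ≤ r → ∀ ω, Z r ω ≤ Z (r + 1) ω)
    (α μ C : ℝ) (hα : 0 < α) (hμ : 0 < μ) (hC : 0 < C)
    (hTail : ∀ l : ℝ, 1 < l → ∀ r : ℕ, 1 ≤ r →
      P {ω | Z r ω ≤ (1 / l) * (r : ℝ) ^ α} ≤ ENNReal.ofReal (C / Real.log l ^ (1 + μ))) :
    P {ω | (α : EReal) ≤ liminf (fun r : ℕ =>
        ((Real.log (Z r ω) / Real.log r : ℝ) : EReal)) atTop} = 1 := by
  obtain ⟨b, -, hbmem, hblim⟩ := exists_seq_strictMono_tendsto' hα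
  have hae : ∀ᵐ ω ∂P, ∀ n, ∀ᶠ k : ℕ in atTop,
      Real.exp (b n * (k * Real.log 2)) < Z (2 ^ k) ω :=
    ae_all_iff.2 fun n => ae_eventually_dyadic_lt_of_tail P Z hμ (hbmem n).2 hTail
  refine (measure_congr (eventuallyEq_univ.2 ?_)).trans measure_univ
  filter_upwards [hae] with ω hω
  refine le_of_tendsto' ((continuous_coe_real_ereal.tendsto α).comp hblim) fun n => ?_
  exact le_liminf_log_div_log_of_dyadic (fun r => Z r ω) (fun r hr => hpos r hr ω)
    (fun r hr => hmono r hr ω) (hbmem n).1 (hω n)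
end

section
/- Let (Ω, 𝓕, P) be a probability space, let β > 0, μ > 0, C > 0, and let (Z_r)_{r≥1} be measurable random variables with values in the positive reals. For each integer k ≥ 1 set λ_k = 2^{k^{(1+μ/2)/(1+μ)}}. Suppose that P( Z_{2^k} ≥ λ_k · (2^k)^β ) ≤ C / (log λ_k)^{1+μ} for every integer k ≥ 1. Then P( limsup_{k→∞} (log Z_{2^k})/(k · log 2) ≤ β ) = 1. -/
open MeasureTheory Filter

/-- A sequence bounded eventually by `β + k ^ (a - 1)` with `a < 1` has `limsup` at most `β`. -/
theorem limsup_coe_le_of_eventually_le_add_rpow {u : ℕ → ℝ} {a β : ℝ} (ha : a < 1)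
    (hu : ∀ᶠ k : ℕ in atTop, u k ≤ β + (k : ℝ) ^ (a - 1)) :
    limsup (fun k => (u k : EReal)) atTop ≤ (β : EReal) := by
  have hpow : Tendsto (fun k : ℕ => (k : ℝ) ^ (a - 1)) atTop (nhds 0) := by
    have h := (tendsto_rpow_neg_atTop (sub_pos.2 ha)).comp (tendsto_natCast_atTop_atTop (R := ℝ))
    simpa [Function.comp_def] using h
  have hlim : Tendsto (fun k : ℕ => ((β + (k : ℝ) ^ (a - 1) : ℝ) : EReal)) atTop
      (nhds (β : EReal)) := by
    rw [EReal.tendsto_coe]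
    simpa using hpow.const_add β
  refine (limsup_le_limsup ?_).trans_eq hlim.limsup_eq
  filter_upwards [hu] with k hk
  exact EReal.coe_le_coe_iff.2 hk

/-- If `z < 2 ^ (k ^ a) * (2 ^ k) ^ β`, then the base-`2 ^ k` logarithm of `z` is at most
`β + k ^ (a - 1)`. -/
theorem log_div_le_add_rpow_of_lt {z a β : ℝ} {k : ℕ} (hk : 1 ≤ k) (hz : 0 < z)
    (h : z < (2 : ℝ) ^ ((k : ℝ) ^ a) * ((2 : ℝ) ^ k) ^ β) :
    Real.log z / ((k : ℝ) * Real.log 2) ≤ β + (k : ℝ) ^ (a - 1) := by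
  have hk0 : (0 : ℝ) < k := by exact_mod_cast hk
  have hlog2 : 0 < Real.log 2 := Real.log_pos one_lt_two
  have hlog := Real.log_le_log hz h.le
  rw [Real.log_mul (by positivity) (by positivity), Real.log_rpow two_pos,
    Real.log_rpow (by positivity), Real.log_pow] at hlog
  rw [div_le_iff₀ (by positivity), Real.rpow_sub_one hk0.ne']
  refine hlog.trans_eq ?_
  field_simp
  ring

/-- The tail bounds `C / (log (2 ^ (k ^ a))) ^ p` are summable when `a * p > 1`. -/
theorem summable_div_log_two_rpow_rpow {a p C : ℝ} (hap : 1 < a * p) :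
    Summable fun k : ℕ => C / Real.log ((2 : ℝ) ^ ((k : ℝ) ^ a)) ^ p := by
  refine ((Real.summable_one_div_nat_rpow.2 hap).mul_left (C / Real.log 2 ^ p)).congr fun k => ?_
  rw [Real.log_rpow two_pos, Real.mul_rpow (by positivity) (Real.log_pos one_lt_two).le,
    ← Real.rpow_mul k.cast_nonneg, div_mul_div_comm, mul_one, mul_comm (Real.log 2 ^ p)]

/-- Borel–Cantelli along the dyadic subsequence: if
`P(Z_{2^k} ≥ λ_k·(2^k)^β) ≤ C/(log λ_k)^{1+μ}` with
`λ_k = 2^{k^{(1+μ/2)/(1+μ)}}`, then almost surely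
`limsup_k (log Z_{2^k})/(k log 2) ≤ β`. -/
theorem iic_dyadic_limsup
    {Ω : Type*} [MeasurableSpace Ω] (P : Measure Ω) [IsProbabilityMeasure P]
    (β μ C : ℝ) (hβ : 0 < β) (hμ : 0 < μ) (hC : 0 < C)
    (Z : ℕ → Ω → ℝ)
    (hmeas : ∀ r, Measurable (Z r))
    (hpos : ∀ r : ℕ, 1 ≤ r → ∀ ω, 0 < Z r ω)
    (hTail : ∀ k : ℕ, 1 ≤ k →
      P {ω | (2 : ℝ) ^ ((k : ℝ) ^ ((1 + μ / 2) / (1 + μ))) * ((2 : ℝ) ^ k) ^ β ≤ Z (2 ^ k) ω}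
        ≤ ENNReal.ofReal
            (C / Real.log ((2 : ℝ) ^ ((k : ℝ) ^ ((1 + μ / 2) / (1 + μ)))) ^ (1 + μ))) :
    P {ω | limsup (fun k : ℕ =>
        ((Real.log (Z (2 ^ k) ω) / ((k : ℝ) * Real.log 2) : ℝ) : EReal)) atTop
          ≤ (β : EReal)} = 1 := by
  set a : ℝ := (1 + μ / 2) / (1 + μ) with ha
  have ha1 : a < 1 := by
    rw [ha, div_lt_one (by positivity)]
    linarith
  have hap : 1 < a * (1 + μ) := by
    rw [ha, div_mul_cancel₀ _ (by positivity)]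
    linarith
  have hsum : ∑' k : ℕ, P {ω | (2 : ℝ) ^ (((k + 1 : ℕ) : ℝ) ^ a) * ((2 : ℝ) ^ (k + 1)) ^ β
      ≤ Z (2 ^ (k + 1)) ω} ≠ ⊤ :=
    ne_top_of_le_ne_top
      ((summable_nat_add_iff 1).2 (summable_div_log_two_rpow_rpow (C := C) hap)).tsum_ofReal_ne_top
      (ENNReal.tsum_le_tsum fun k => hTail (k + 1) k.succ_pos)
  rw [← measure_univ (μ := P)]
  refine measure_congr (eventuallyEq_univ.2 ?_)
  filter_upwards [ae_eventually_notMem hsum] with ω hω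
  refine limsup_coe_le_of_eventually_le_add_rpow ha1 ?_
  rw [← map_add_atTop_eq_nat 1, eventually_map]
  filter_upwards [hω] with k hk
  exact log_div_le_add_rpow_of_lt k.succ_pos (hpos _ Nat.one_le_two_pow ω) (not_le.1 hk)
end

section
/- Let (Ω, 𝓕, P) be a probability space, let α > 0, μ > 0, C > 0, and let (Z_r)_{r≥1} be measurable random variables with values in the positive reals. For each integer k ≥ 1 set λ_k = 2^{k^{(1+μ/2)/(1+μ)}}. Suppose that P( Z_{2^k} ≤ (1/λ_k) · (2^k)^α ) ≤ C / (log λ_k)^{1+μ} for every integer k ≥ 1. Then P( liminf_{k→∞} (log Z_{2^k})/(k · log 2) ≥ α ) = 1. -/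
open MeasureTheory Filter

/-- Borel–Cantelli with polynomial tails: if the `k`-th event has probability at most `K / k ^ p` with
`1 < p`, then almost surely only finitely many of the events occur. -/
theorem ae_eventually_not_of_le_div_rpow {Ω : Type*} [MeasurableSpace Ω] {P : Measure Ω}
    {K p : ℝ} (hp : 1 < p) {A : ℕ → Set Ω}
    (hA : ∀ k : ℕ, 1 ≤ k → P (A k) ≤ ENNReal.ofReal (K / (k : ℝ) ^ p)) :
    ∀ᵐ ω ∂P, ∀ᶠ k in atTop, ω ∉ A k := by
  have hsum : Summable fun k : ℕ => K / (k : ℝ) ^ p := by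
    simpa only [mul_one_div] using (Real.summable_one_div_nat_rpow.mpr hp).mul_left K
  have hle : ∀ k : ℕ, P {ω | 1 ≤ k ∧ ω ∈ A k} ≤ ENNReal.ofReal (K / (k : ℝ) ^ p) := by
    intro k
    by_cases hk : 1 ≤ k
    · simpa [hk] using hA k hk
    · simp [hk]
  have hfin : ∑' k, P {ω | 1 ≤ k ∧ ω ∈ A k} ≠ ⊤ :=
    ne_top_of_le_ne_top hsum.tsum_ofReal_ne_top (ENNReal.tsum_le_tsum hle)
  filter_upwards [ae_eventually_notMem hfin] with ω hω
  filter_upwards [hω, eventually_ge_atTop 1] with k hk h1 hmem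
  exact hk ⟨h1, hmem⟩

/-- A sequence eventually bounded below by `a - k ^ (γ - 1)` with `γ < 1` has lower limit at
least `a`. -/
theorem le_liminf_of_sub_rpow_le {a γ : ℝ} (hγ : γ < 1) {u : ℕ → ℝ}
    (hu : ∀ᶠ k : ℕ in atTop, a - (k : ℝ) ^ (γ - 1) ≤ u k) :
    (a : EReal) ≤ liminf (fun k => (u k : EReal)) atTop := by
  have hpow : Tendsto (fun k : ℕ => (k : ℝ) ^ (γ - 1)) atTop (nhds 0) := by
    simpa only [neg_sub, Function.comp_def] using
      (tendsto_rpow_neg_atTop (sub_pos.mpr hγ)).comp tendsto_natCast_atTop_atTop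
  have hlim : Tendsto (fun k : ℕ => ((a - (k : ℝ) ^ (γ - 1) : ℝ) : EReal)) atTop
      (nhds (a : EReal)) :=
    (continuous_coe_real_ereal.tendsto a).comp (by simpa using hpow.const_sub a)
  rw [← hlim.liminf_eq]
  exact liminf_le_liminf (hu.mono fun k hk => EReal.coe_le_coe_iff.mpr hk)

/-- Logarithmic form of the lower bound `(b ^ k) ^ a / b ^ (k ^ γ) < z` in base `b = 2`. -/
theorem sub_rpow_le_log_div {a γ z : ℝ} {k : ℕ} (hk : 1 ≤ k)
    (hz : 1 / (2 : ℝ) ^ ((k : ℝ) ^ γ) * ((2 : ℝ) ^ k) ^ a < z) :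
    a - (k : ℝ) ^ (γ - 1) ≤ Real.log z / (k * Real.log 2) := by
  have hk0 : (0 : ℝ) < k := by exact_mod_cast hk
  have hlog2 : 0 < Real.log 2 := Real.log_pos one_lt_two
  have hlog := Real.log_lt_log (by positivity) hz
  rw [Real.log_mul (by positivity) (by positivity), one_div, Real.log_inv,
    Real.log_rpow two_pos, Real.log_rpow (by positivity), Real.log_pow] at hlog
  rw [le_div_iff₀ (by positivity), Real.rpow_sub_one hk0.ne']
  have : (a - (k : ℝ) ^ γ / k) * (k * Real.log 2)
      = -((k : ℝ) ^ γ * Real.log 2) + a * (k * Real.log 2) := by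
    field_simp
    ring
  exact this.trans_le hlog.le

/-- Borel–Cantelli along the dyadic subsequence: if
`P(Z_{2^k} ≤ (1/λ_k)·(2^k)^α) ≤ C/(log λ_k)^{1+μ}` with
`λ_k = 2^{k^{(1+μ/2)/(1+μ)}}`, then almost surely
`liminf_k (log Z_{2^k})/(k log 2) ≥ α`. -/
theorem iic_dyadic_liminf
    {Ω : Type*} [MeasurableSpace Ω] (P : Measure Ω) [IsProbabilityMeasure P]
    (α μ C : ℝ) (hα : 0 < α) (hμ : 0 < μ) (hC : 0 < C)
    (Z : ℕ → Ω → ℝ)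
    (hmeas : ∀ r, Measurable (Z r))
    (hpos : ∀ r : ℕ, 1 ≤ r → ∀ ω, 0 < Z r ω)
    (hTail : ∀ k : ℕ, 1 ≤ k →
      P {ω | Z (2 ^ k) ω ≤
          (1 / (2 : ℝ) ^ ((k : ℝ) ^ ((1 + μ / 2) / (1 + μ)))) * ((2 : ℝ) ^ k) ^ α}
        ≤ ENNReal.ofReal
            (C / Real.log ((2 : ℝ) ^ ((k : ℝ) ^ ((1 + μ / 2) / (1 + μ)))) ^ (1 + μ))) :
    P {ω | (α : EReal) ≤ liminf (fun k : ℕ =>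
        ((Real.log (Z (2 ^ k) ω) / ((k : ℝ) * Real.log 2) : ℝ) : EReal)) atTop} = 1 := by
  have hμ1 : 0 < 1 + μ := by linarith
  have hlog2 : 0 < Real.log 2 := Real.log_pos one_lt_two
  have hγ : (1 + μ / 2) / (1 + μ) < 1 := by
    rw [div_lt_one hμ1]
    linarith
  have hbound : ∀ k : ℕ,
      C / Real.log ((2 : ℝ) ^ ((k : ℝ) ^ ((1 + μ / 2) / (1 + μ)))) ^ (1 + μ)
        = C / Real.log 2 ^ (1 + μ) / (k : ℝ) ^ (1 + μ / 2) := by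
    intro k
    rw [Real.log_rpow two_pos, Real.mul_rpow (by positivity) hlog2.le,
      ← Real.rpow_mul k.cast_nonneg, div_mul_cancel₀ _ hμ1.ne', div_div, mul_comm]
  have hae := ae_eventually_not_of_le_div_rpow (P := P) (K := C / Real.log 2 ^ (1 + μ))
    (p := 1 + μ / 2) (by linarith)
    (fun k hk => (hTail k hk).trans_eq (by rw [hbound]))
  refine (measure_congr (eventuallyEq_univ.mpr ?_)).trans measure_univ
  filter_upwards [hae] with ω hω
  apply le_liminf_of_sub_rpow_le hγ
  filter_upwards [hω, eventually_ge_atTop 1] with k hk h1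
  exact sub_rpow_le_log_div h1 (not_le.mp hk)
end

section
/- Let (Ω, 𝓕, P) be a probability space and let C > 0. Suppose we are given: (a) for every real ε ∈ (0,1) and every integer r ≥ 1 a measurable event G_{ε,r} ⊆ Ω with P(G_{ε,r}) ≤ C·√ε; (b) for every real s > 0 a measurable random variable B_s ≥ 0 such that P( B_s ≤ (1/λ)·s² ) ≤ C/λ for every real λ > 1 and every real s > 0; (c) for every integer r ≥ 1 a measurable random variable X_r ≥ 0 such that for every ε ∈ (0,1), every r ≥ 1 and every ω ∉ G_{ε,r} one has B_{ε·r²}(ω) ≤ X_r(ω). Then for every real λ > 1 and every integer r ≥ 1, P( X_r ≤ (1/λ)·r⁴ ) ≤ 2C · λ^{−1/5}. -/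
open MeasureTheory

/-- Abstract form of Theorem 3 (the crucial theorem): splitting on the events
`G_{ε,r}` with `ε = λ^{-2/5}` yields `P(X_r ≤ (1/λ)·r⁴) ≤ 2C·λ^{-1/5}`. -/
theorem crucial_bound
    {Ω : Type*} [MeasurableSpace Ω] (P : Measure Ω) [IsProbabilityMeasure P]
    (C : ℝ) (hC : 0 < C)
    (G : ℝ → ℕ → Set Ω)
    (hGmeas : ∀ ε r, MeasurableSet (G ε r))
    (hG : ∀ ε : ℝ, 0 < ε → ε < 1 → ∀ r : ℕ, 1 ≤ r →
      P (G ε r) ≤ ENNReal.ofReal (C * Real.sqrt ε))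
    (B : ℝ → Ω → ℝ)
    (hBmeas : ∀ s, Measurable (B s))
    (hBnonneg : ∀ s ω, 0 ≤ B s ω)
    (hB : ∀ l : ℝ, 1 < l → ∀ s : ℝ, 0 < s →
      P {ω | B s ω ≤ (1 / l) * s ^ 2} ≤ ENNReal.ofReal (C / l))
    (X : ℕ → Ω → ℝ)
    (hXmeas : ∀ r, Measurable (X r))
    (hXnonneg : ∀ r ω, 0 ≤ X r ω)
    (hBX : ∀ ε : ℝ, 0 < ε → ε < 1 → ∀ r : ℕ, 1 ≤ r → ∀ ω, ω ∉ G ε r →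
      B (ε * (r : ℝ) ^ 2) ω ≤ X r ω) :
    ∀ l : ℝ, 1 < l → ∀ r : ℕ, 1 ≤ r →
      P {ω | X r ω ≤ (1 / l) * (r : ℝ) ^ 4}
        ≤ ENNReal.ofReal (2 * C * l ^ (-(1 / 5) : ℝ)) := by
  intro l hl r hr
  have hl0 : 0 < l := by linarith
  have hr0 : (0 : ℝ) < r := by exact_mod_cast hr
  set a : ℝ := l ^ (-(1 / 5) : ℝ) with ha
  have ha0 : 0 < a := Real.rpow_pos_of_pos hl0 _
  have ha1 : a < 1 := Real.rpow_lt_one_of_one_lt_of_neg hl (by norm_num)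
  have ha5 : 1 / l = a ^ 5 := by
    rw [ha, ← Real.rpow_natCast, ← Real.rpow_mul hl0.le, one_div, ← Real.rpow_neg_one]
    norm_num
  have hε0 : 0 < a ^ 2 := by positivity
  have hε1 : a ^ 2 < 1 := pow_lt_one₀ ha0.le ha1 two_ne_zero
  have hPG := hG (a ^ 2) hε0 hε1 r hr
  rw [Real.sqrt_sq ha0.le] at hPG
  have hPB := hB a⁻¹ ((one_lt_inv₀ ha0).2 ha1) (a ^ 2 * (r : ℝ) ^ 2) (by positivity)
  rw [div_inv_eq_mul, div_inv_eq_mul, one_mul] at hPB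
  have hsub : {ω | X r ω ≤ (1 / l) * (r : ℝ) ^ 4} ⊆
      G (a ^ 2) r ∪ {ω | B (a ^ 2 * (r : ℝ) ^ 2) ω ≤ a * (a ^ 2 * (r : ℝ) ^ 2) ^ 2} := by
    intro ω hω
    refine or_iff_not_imp_left.2 fun hωG ↦ ?_
    calc B (a ^ 2 * (r : ℝ) ^ 2) ω ≤ X r ω := hBX _ hε0 hε1 r hr ω hωG
      _ ≤ (1 / l) * (r : ℝ) ^ 4 := hω
      _ = a * (a ^ 2 * (r : ℝ) ^ 2) ^ 2 := by rw [ha5]; ring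
  calc P {ω | X r ω ≤ (1 / l) * (r : ℝ) ^ 4}
      ≤ P (G (a ^ 2) r) +
          P {ω | B (a ^ 2 * (r : ℝ) ^ 2) ω ≤ a * (a ^ 2 * (r : ℝ) ^ 2) ^ 2} :=
        (measure_mono hsub).trans (measure_union_le _ _)
    _ ≤ ENNReal.ofReal (C * a) + ENNReal.ofReal (C * a) := add_le_add hPG hPB
    _ = ENNReal.ofReal (2 * C * a) := by
        rw [← ENNReal.ofReal_add (by positivity) (by positivity)]
        ring_nf
end

section
/- Let (Ω, 𝓕, P) be a probability space and let C > 0. Let X_1 ≤ X_2 ≤ … and Y_1 ≤ Y_2 ≤ … be nondecreasing sequences of measurable random variables with values in the positive reals such that Y_r(ω) ≤ X_r(ω) for every integer r ≥ 1 and every ω ∈ Ω. Suppose that E[X_r] ≤ C·r⁴ for every integer r ≥ 1, and that P( Y_r ≤ (1/λ)·r⁴ ) ≤ C·λ^{−1/5} for every real λ > 1 and every integer r ≥ 1. Then P( lim_{r→∞} (log X_r)/(log r) = 4 ) = 1 and P( lim_{r→∞} (log Y_r)/(log r) = 4 ) = 1, i.e. almost surely both limits exist and equal 4. -/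
open MeasureTheory Filter

/-- If `f` is positive and monotone and, along powers of two, agrees with `r ^ 4` up to a factor
polynomial in `log r`, then `log (f r) / log r → 4`. -/
theorem tendsto_log_div_log_of_dyadic_bounds (f : ℕ → ℝ)
    (hpos : ∀ r : ℕ, 1 ≤ r → 0 < f r)
    (hmono : ∀ r : ℕ, 1 ≤ r → f r ≤ f (r + 1))
    (hlow : ∀ᶠ k : ℕ in atTop, ((2 : ℝ) ^ k) ^ 4 / ((k : ℝ) + 2) ^ 10 ≤ f (2 ^ k))
    (hup : ∀ᶠ k : ℕ in atTop, f (2 ^ k) ≤ ((2 : ℝ) ^ k) ^ 4 * ((k : ℝ) + 2) ^ 10) :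
    Tendsto (fun r : ℕ => Real.log (f r) / Real.log r) atTop (nhds 4) := by
  have hmono' : ∀ a b : ℕ, 1 ≤ a → a ≤ b → f a ≤ f b := by
    intro a b ha hab
    induction b, hab using Nat.le_induction with
    | base => exact le_rfl
    | succ n hn ih => exact ih.trans (hmono n (ha.trans hn))
  have hlog2 : 0 < Real.log 2 := Real.log_pos one_lt_two
  have hk : Tendsto (fun r : ℕ => Nat.log 2 r) atTop atTop := by
    refine tendsto_atTop_atTop.2 fun b => ⟨2 ^ b, fun r hr => ?_⟩
    exact Nat.le_log_of_pow_le one_lt_two hr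
  have herr : Tendsto (fun k : ℕ =>
      (10 * Real.log ((k : ℝ) + 3) + 4 * Real.log 2) / (k * Real.log 2)) atTop (nhds 0) := by
    have hx : Tendsto (fun k : ℕ => (k : ℝ) + 3) atTop atTop :=
      tendsto_atTop_add_const_right _ _ tendsto_natCast_atTop_atTop
    have ho : (fun k : ℕ => 10 * Real.log ((k : ℝ) + 3) + 4 * Real.log 2)
        =o[atTop] fun k : ℕ => (k : ℝ) := by
      have hc : ∀ c : ℝ, (fun _ : ℕ => c) =o[atTop] fun k : ℕ => (k : ℝ) := fun c =>
        Asymptotics.isLittleO_const_left.2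
          (Or.inr (tendsto_norm_atTop_atTop.comp tendsto_natCast_atTop_atTop))
      have h1 : (fun k : ℕ => (k : ℝ) + 3) =O[atTop] fun k : ℕ => (k : ℝ) :=
        (Asymptotics.isBigO_refl _ _).add (hc 3).isBigO
      exact (((Real.isLittleO_log_id_atTop.comp_tendsto hx).trans_isBigO h1).const_mul_left 10).add
        (hc _)
    have h := ho.tendsto_div_nhds_zero.div_const (Real.log 2)
    simpa [div_div] using h
  have hbound : ∀ᶠ r : ℕ in atTop, |Real.log (f r) / Real.log r - 4| ≤
      (10 * Real.log ((Nat.log 2 r : ℝ) + 3) + 4 * Real.log 2) /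
        ((Nat.log 2 r : ℝ) * Real.log 2) := by
    filter_upwards [hk.eventually hlow,
      (tendsto_add_atTop_nat 1).comp hk |>.eventually hup,
      hk.eventually (eventually_ge_atTop 1), eventually_ge_atTop 1] with r h1 h2 h3 h4
    simp only [Function.comp_apply] at h2
    have hp1 : 2 ^ Nat.log 2 r ≤ r := Nat.pow_log_le_self 2 (by omega)
    have hp2 : r ≤ 2 ^ (Nat.log 2 r + 1) := (Nat.lt_pow_succ_log_self one_lt_two r).le
    generalize Nat.log 2 r = k at *
    have hr0 : (0 : ℝ) < r := by exact_mod_cast h4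
    have hk0 : (1 : ℝ) ≤ k := by exact_mod_cast h3
    have hl1 : k * Real.log 2 ≤ Real.log r := by
      rw [← Real.log_pow]
      exact Real.log_le_log (by positivity) (by exact_mod_cast hp1)
    have hl2 : Real.log r ≤ (k + 1) * Real.log 2 := by
      have : Real.log r ≤ Real.log (2 ^ (k + 1)) :=
        Real.log_le_log hr0 (by exact_mod_cast hp2)
      rw [Real.log_pow] at this
      exact_mod_cast this
    have hf1 : 4 * (k * Real.log 2) - 10 * Real.log ((k : ℝ) + 2) ≤ Real.log (f r) := by
      have := Real.log_le_log (by positivity) (h1.trans (hmono' _ _ Nat.one_le_two_pow hp1))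
      rw [Real.log_div (by positivity) (by positivity), Real.log_pow, Real.log_pow,
        Real.log_pow] at this
      exact_mod_cast this
    have hf2 : Real.log (f r) ≤
        4 * ((k + 1) * Real.log 2) + 10 * Real.log ((k : ℝ) + 3) := by
      have := Real.log_le_log (hpos r h4) ((hmono' _ _ h4 hp2).trans h2)
      rw [Real.log_mul (by positivity) (by positivity), Real.log_pow, Real.log_pow,
        Real.log_pow] at this
      push_cast at this
      rwa [show (k : ℝ) + 1 + 2 = k + 3 by ring] at this
    have h23 : Real.log ((k : ℝ) + 2) ≤ Real.log ((k : ℝ) + 3) :=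
      Real.log_le_log (by positivity) (by linarith)
    have hden : 0 < k * Real.log 2 := by positivity
    have hlr : 0 < Real.log r := hden.trans_le hl1
    have hnum : |Real.log (f r) - 4 * Real.log r| ≤
        10 * Real.log ((k : ℝ) + 3) + 4 * Real.log 2 := by
      rw [abs_le]
      constructor <;> linarith
    have heq : Real.log (f r) / Real.log r - 4 =
        (Real.log (f r) - 4 * Real.log r) / Real.log r := by
      field_simp
    rw [heq, abs_div, abs_of_pos hlr]
    exact div_le_div₀ ((abs_nonneg _).trans hnum) hnum hden hl1
  rw [tendsto_iff_norm_sub_tendsto_zero]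
  exact squeeze_zero' (Eventually.of_forall fun _ => norm_nonneg _) hbound (herr.comp hk)

theorem summable_const_div_natCast_add_two_sq (C : ℝ) :
    Summable fun k : ℕ => C / ((k : ℝ) + 2) ^ 2 := by
  have h := (summable_nat_add_iff 2).2 (Real.summable_one_div_nat_pow.2 one_lt_two)
  simpa [div_eq_mul_inv] using h.mul_left C

/-- First Borel–Cantelli lemma with the summable bounds `C / (k + 2) ^ 2`. -/
theorem ae_eventually_not_of_measure_le_div_sq {Ω : Type*} [MeasurableSpace Ω] (P : Measure Ω)
    (C : ℝ) (s : ℕ → Set Ω) (hs : ∀ k : ℕ, P (s k) ≤ ENNReal.ofReal (C / ((k : ℝ) + 2) ^ 2)) :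
    ∀ᵐ ω ∂P, ∀ᶠ k in atTop, ω ∉ s k :=
  ae_eventually_notMem (ne_top_of_le_ne_top
    (summable_const_div_natCast_add_two_sq C).tsum_ofReal_ne_top (ENNReal.tsum_le_tsum hs))

/-- Abstract form of Theorem 1 (mass dimension of the IIC is 4):
if `E[X_r] ≤ C·r⁴`, `P(Y_r ≤ (1/λ)·r⁴) ≤ C·λ^{-1/5}` and `Y_r ≤ X_r`,
then almost surely `lim (log X_r)/(log r) = lim (log Y_r)/(log r) = 4`. -/
theorem mass_dimension_four
    {Ω : Type*} [MeasurableSpace Ω] (P : Measure Ω) [IsProbabilityMeasure P]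
    (C : ℝ) (hC : 0 < C)
    (X Y : ℕ → Ω → ℝ)
    (hXmeas : ∀ r, Measurable (X r)) (hYmeas : ∀ r, Measurable (Y r))
    (hXpos : ∀ r : ℕ, 1 ≤ r → ∀ ω, 0 < X r ω)
    (hYpos : ∀ r : ℕ, 1 ≤ r → ∀ ω, 0 < Y r ω)
    (hXmono : ∀ r : ℕ, 1 ≤ r → ∀ ω, X r ω ≤ X (r + 1) ω)
    (hYmono : ∀ r : ℕ, 1 ≤ r → ∀ ω, Y r ω ≤ Y (r + 1) ω)
    (hYX : ∀ r : ℕ, 1 ≤ r → ∀ ω, Y r ω ≤ X r ω)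
    (hXint : ∀ r : ℕ, 1 ≤ r → Integrable (X r) P)
    (hXE : ∀ r : ℕ, 1 ≤ r → (∫ ω, X r ω ∂P) ≤ C * (r : ℝ) ^ 4)
    (hYtail : ∀ l : ℝ, 1 < l → ∀ r : ℕ, 1 ≤ r →
      P {ω | Y r ω ≤ (1 / l) * (r : ℝ) ^ 4}
        ≤ ENNReal.ofReal (C * l ^ (-(1 / 5) : ℝ))) :
    P {ω | Tendsto (fun r : ℕ => Real.log (X r ω) / Real.log r) atTop (nhds 4)} = 1 ∧
    P {ω | Tendsto (fun r : ℕ => Real.log (Y r ω) / Real.log r) atTop (nhds 4)} = 1 := by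
  have hXY : ∀ᵐ ω ∂P, ∀ᶠ k : ℕ in atTop,
      ((2 : ℝ) ^ k) ^ 4 / ((k : ℝ) + 2) ^ 10 ≤ Y (2 ^ k) ω ∧
      X (2 ^ k) ω ≤ ((2 : ℝ) ^ k) ^ 4 * ((k : ℝ) + 2) ^ 10 := by
    have hY := ae_eventually_not_of_measure_le_div_sq P C
      (fun k : ℕ => {ω | Y (2 ^ k) ω ≤ 1 / ((k : ℝ) + 2) ^ 10 * ((2 ^ k : ℕ) : ℝ) ^ 4})
      (fun k => by
        have hk : (1 : ℝ) < (k : ℝ) + 2 := by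
          have : (0 : ℝ) ≤ k := k.cast_nonneg
          linarith
        refine (hYtail (((k : ℝ) + 2) ^ 10) (one_lt_pow₀ hk (by norm_num)) (2 ^ k)
          Nat.one_le_two_pow).trans_eq ?_
        rw [← Real.rpow_natCast ((k : ℝ) + 2) 10, ← Real.rpow_mul (by positivity),
          show ((10 : ℕ) : ℝ) * (-(1 / 5)) = -(2 : ℕ) by norm_num,
          Real.rpow_neg (by positivity), Real.rpow_natCast, div_eq_mul_inv])
    have hX := ae_eventually_not_of_measure_le_div_sq P C
      (fun k : ℕ => {ω | ((2 : ℝ) ^ k) ^ 4 * ((k : ℝ) + 2) ^ 10 ≤ X (2 ^ k) ω})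
      (fun k => by
        have hm := mul_meas_ge_le_integral_of_nonneg
          (ae_of_all P fun ω => (hXpos (2 ^ k) Nat.one_le_two_pow ω).le)
          (hXint (2 ^ k) Nat.one_le_two_pow) (((2 : ℝ) ^ k) ^ 4 * ((k : ℝ) + 2) ^ 10)
        have hE := hXE (2 ^ k) Nat.one_le_two_pow
        push_cast at hE
        rw [← ofReal_measureReal]
        apply ENNReal.ofReal_le_ofReal
        have hk : (1 : ℝ) ≤ (k : ℝ) + 2 := by
          have : (0 : ℝ) ≤ k := k.cast_nonneg
          linarith
        have h4 : (0 : ℝ) < (2 ^ k) ^ 4 := by positivity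
        have hle : P.real {ω | ((2 : ℝ) ^ k) ^ 4 * ((k : ℝ) + 2) ^ 10 ≤ X (2 ^ k) ω} *
            ((k : ℝ) + 2) ^ 10 ≤ C := by
          refine le_of_mul_le_mul_left ?_ h4
          linarith
        rw [le_div_iff₀ (by positivity)]
        refine le_trans ?_ hle
        exact mul_le_mul_of_nonneg_left (pow_le_pow_right₀ hk (by norm_num)) measureReal_nonneg)
    filter_upwards [hX, hY] with ω h1 h2
    filter_upwards [h1, h2] with k h3 h4
    simp only [not_le] at h3 h4
    push_cast at h4
    rw [one_div_mul_eq_div] at h4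
    exact ⟨h4.le, h3.le⟩
  have hone : ∀ s : Set Ω, s ∈ ae P → P s = 1 := fun s hs => by
    rw [measure_congr (eventuallyEq_univ.2 hs), measure_univ]
  constructor
  · refine hone _ ?_
    filter_upwards [hXY] with ω h
    exact tendsto_log_div_log_of_dyadic_bounds (X · ω) (hXpos · · ω) (hXmono · · ω)
      (h.mono fun k hk => hk.1.trans (hYX _ Nat.one_le_two_pow ω)) (h.mono fun k hk => hk.2)
  · refine hone _ ?_
    filter_upwards [hXY] with ω h
    exact tendsto_log_div_log_of_dyadic_bounds (Y · ω) (hYpos · · ω) (hYmono · · ω)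
      (h.mono fun k hk => hk.1)
      (h.mono fun k hk => (hYX _ Nat.one_le_two_pow ω).trans hk.2)
end
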